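/- arXiv:2112.02380 — 3 statements merged into one kernel-verified Lean document; each statement's English description precedes it below -/
import Mathlib

section
/- Let σ be a finite type linearly ordered by an injective positive weight function w : σ → ℝ, let B be a subgroup of the chain group (Finset σ, ∆), and let z be a chain. If z* is the lexicographically (colex) minimal chain in the homology class of z (i.e. z* ∆ z ∈ B and z* ≤_L y for every y with y ∆ z ∈ B), then z* is also bottleneck-optimal in that class: bn_w(z*) ≤ bn_w(y) for every chain y with y ∆ z ∈ B. -/
open scoped symmDiff

/-- The bottleneck norm of a ℤ₂-chain (identified with its support, a `Finset σ`):
`bn w ∅ = 0` and `bn w c = max_{s ∈ c} w s` for `c ≠ ∅`. -/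
noncomputable def bn {σ : Type*} (w : σ → ℝ) (c : Finset σ) : ℝ :=
  if h : c.Nonempty then c.sup' h w else 0

/-- The strict lexicographic (colex) order on chains induced by `w`:
`x <_L y` iff the `w`-largest element of `x ∆ y` exists and lies in `y`
(for injective `w` this is Mathlib's `Finset.Colex` order with the linear
order on `σ` pulled back along `w`; note it forces `x ∆ y ≠ ∅`, i.e. `x ≠ y`). -/
def colexLt {σ : Type*} [DecidableEq σ] (w : σ → ℝ) (x y : Finset σ) : Prop :=
  ∃ s ∈ x ∆ y, (∀ t ∈ x ∆ y, w t ≤ w s) ∧ s ∈ y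

/-- The (non-strict) lexicographic order `≤_L` on chains induced by `w`. -/
def colexLe {σ : Type*} [DecidableEq σ] (w : σ → ℝ) (x y : Finset σ) : Prop :=
  x = y ∨ colexLt w x y

theorem le_bn {σ : Type*} (w : σ → ℝ) {c : Finset σ} {s : σ} (hs : s ∈ c) : w s ≤ bn w c := by
  rw [bn, dif_pos ⟨s, hs⟩]
  exact Finset.le_sup' w hs

theorem bn_nonneg {σ : Type*} (w : σ → ℝ) (hw : ∀ s, 0 ≤ w s) (c : Finset σ) : 0 ≤ bn w c := by
  rcases c.eq_empty_or_nonempty with rfl | ⟨s, hs⟩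
  · simp [bn]
  · exact (hw s).trans (le_bn w hs)

theorem bn_le {σ : Type*} (w : σ → ℝ) {c : Finset σ} {r : ℝ} (hr : 0 ≤ r)
    (h : ∀ s ∈ c, w s ≤ r) : bn w c ≤ r := by
  unfold bn
  split_ifs with hc
  · exact Finset.sup'_le hc w h
  · exact hr

/-- For nonnegative weights, the bottleneck norm is monotone along the lexicographic order. -/
theorem bn_le_of_colexLt {σ : Type*} [DecidableEq σ] (w : σ → ℝ) (hw : ∀ s, 0 ≤ w s)
    {x y : Finset σ} (h : colexLt w x y) : bn w x ≤ bn w y := by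
  obtain ⟨s, -, hmax, hsy⟩ := h
  refine bn_le w (bn_nonneg w hw y) fun t htx => ?_
  by_cases hty : t ∈ y
  · exact le_bn w hty
  · exact (hmax t (Finset.mem_symmDiff.2 (Or.inl ⟨htx, hty⟩))).trans (le_bn w hsy)

/-- the lexicographically (colex) minimal chain in the homology class of
`z` (with respect to a subgroup `B` of the chain group `(Finset σ, ∆)`) is also
bottleneck-optimal in that class. -/
theorem lex_optimal_is_bottleneck_optimal {σ : Type*} [Fintype σ] [DecidableEq σ]
    (w : σ → ℝ) (hw : Function.Injective w) (hpos : ∀ s, 0 < w s)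
    (B : Set (Finset σ)) (hB0 : ∅ ∈ B) (hBadd : ∀ x ∈ B, ∀ y ∈ B, x ∆ y ∈ B)
    (z zstar : Finset σ) (hz : zstar ∆ z ∈ B)
    (hmin : ∀ y : Finset σ, y ∆ z ∈ B → colexLe w zstar y) :
    ∀ y : Finset σ, y ∆ z ∈ B → bn w zstar ≤ bn w y := by
  intro y hy
  rcases hmin y hy with rfl | hlt
  · exact le_rfl
  · exact bn_le_of_colexLt w (fun s => (hpos s).le) hlt
end

section
/- Existence and uniqueness of the lexicographic-optimal homology basis: let σ be a finite type linearly ordered by an injective positive weight function w : σ → ℝ, let the chain space be the ℤ₂-vector space σ → ZMod 2 (a chain identified with its support in Finset σ), and let B ≤ Z be ZMod 2-submodules of the chain space (boundaries inside cycles), with k the dimension of the quotient Z/B. Then there is a unique sequence of cycles z_1, …, z_k in Z such that for each i, z_i is the lexicographically (colex) minimal element of the set of cycles in Z that do not lie in the submodule B + span{z_1, …, z_{i−1}}; moreover the images of z_1, …, z_k in Z/B form a basis of Z/B. -/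
open scoped symmDiff

/-- The support of a ℤ₂-chain `c : σ → ZMod 2`, as a `Finset σ`. -/
def supp {σ : Type*} [Fintype σ] [DecidableEq σ] (c : σ → ZMod 2) : Finset σ :=
  Finset.univ.filter fun s => c s ≠ 0

/-- `c` is the colex-least element of `Z` outside `W`. -/
def IsColexLeast {σ : Type*} [Fintype σ] [DecidableEq σ] (w : σ → ℝ)
    (Z W : Submodule (ZMod 2) (σ → ZMod 2)) (c : σ → ZMod 2) : Prop :=
  c ∈ Z ∧ c ∉ W ∧ ∀ y ∈ Z, y ∉ W → colexLe w (supp c) (supp y)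

theorem supp_injective {σ : Type*} [Fintype σ] [DecidableEq σ] :
    Function.Injective (supp : (σ → ZMod 2) → Finset σ) := by
  have zmod_two : ∀ a b : ZMod 2, (a ≠ 0 ↔ b ≠ 0) → a = b := by decide
  intro x y h
  funext s
  exact zmod_two _ _ (by simpa [supp] using Finset.ext_iff.1 h s)

theorem colexLe_antisymm {σ : Type*} [DecidableEq σ] {w : σ → ℝ} (hw : Function.Injective w)
    {x y : Finset σ} (hxy : colexLe w x y) (hyx : colexLe w y x) : x = y := by
  rcases hxy with h | ⟨s, hs, hmax, hsy⟩
  · exact h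
  rcases hyx with h | ⟨t, ht, tmax, htx⟩
  · exact h.symm
  rw [symmDiff_comm] at ht tmax
  obtain rfl : s = t := hw (le_antisymm (tmax s hs) (hmax t ht))
  simp [Finset.mem_symmDiff, hsy, htx] at hs

theorem exists_colexLe_of_nonempty {σ : Type*} [DecidableEq σ] {w : σ → ℝ}
    (hw : Function.Injective w) {S : Set (Finset σ)} (hfin : S.Finite) (hS : S.Nonempty) :
    ∃ x ∈ S, ∀ y ∈ S, colexLe w x y := by
  let _ : LinearOrder σ := LinearOrder.lift' w hw
  obtain ⟨x, hx, hmin⟩ := Set.exists_min_image S toColex hfin hS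
  refine ⟨x, hx, fun y hy => ?_⟩
  by_cases hxy : x = y
  · exact Or.inl hxy
  obtain ⟨s, hs, hmax⟩ := Finset.exists_max_image (x ∆ y) w
    (Finset.nonempty_iff_ne_empty.2 fun h => hxy (symmDiff_eq_bot.1 h))
  refine Or.inr ⟨s, hs, hmax, ?_⟩
  by_contra hsy
  have hsx : s ∈ x := by
    simpa [Finset.mem_symmDiff, hsy] using hs
  obtain ⟨b, hby, hbx, hsb⟩ := Finset.Colex.toColex_le_toColex.1 (hmin y hy) hsx hsy
  have hbs : w b ≤ w s := hmax b (Finset.mem_symmDiff.2 (Or.inr ⟨hby, hbx⟩))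
  obtain rfl : s = b := hw (le_antisymm hsb hbs)
  exact hbx hsx

namespace IsColexLeast

variable {σ : Type*} [Fintype σ] [DecidableEq σ] {w : σ → ℝ}
  {Z W : Submodule (ZMod 2) (σ → ZMod 2)}

theorem unique (hw : Function.Injective w) {c d : σ → ZMod 2}
    (hc : IsColexLeast w Z W c) (hd : IsColexLeast w Z W d) : c = d :=
  supp_injective (colexLe_antisymm hw (hc.2.2 d hd.1 hd.2.1) (hd.2.2 c hc.1 hc.2.1))

theorem exists_of_not_le (hw : Function.Injective w) (h : ¬Z ≤ W) :
    ∃ c, IsColexLeast w Z W c := by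
  obtain ⟨y, hyZ, hyW⟩ := SetLike.not_le_iff_exists.1 h
  obtain ⟨_, ⟨c, ⟨hcZ, hcW⟩, rfl⟩, hmin⟩ := exists_colexLe_of_nonempty hw
    (S := supp '' {c | c ∈ Z ∧ c ∉ W}) (Set.toFinite _) ⟨_, y, ⟨hyZ, hyW⟩, rfl⟩
  exact ⟨c, hcZ, hcW, fun y hy hyW => hmin _ ⟨y, ⟨hy, hyW⟩, rfl⟩⟩

end IsColexLeast

theorem iterate_sup_span_singleton {K V : Type*} [Semiring K] [AddCommMonoid V] [Module K V]
    (m : Submodule K V → V) (B : Submodule K V) (n : ℕ) :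
    (fun W => W ⊔ Submodule.span K {m W})^[n] B =
      B ⊔ Submodule.span K
        ((fun j => m ((fun W => W ⊔ Submodule.span K {m W})^[j] B)) '' {j | j < n}) := by
  induction n with
  | zero => simp
  | succ n ih =>
    have hset : {j | j < n + 1} = insert n {j | j < n} := by ext; simp; omega
    rw [hset, Set.image_insert_eq, Submodule.span_insert, sup_comm (Submodule.span K {_}),
      ← sup_assoc, ← ih, Function.iterate_succ_apply']

theorem finrank_iterate_sup_span_singleton_le {K V : Type*} [DivisionRing K] [AddCommGroup V]
    [Module K V] [FiniteDimensional K V] (m : Submodule K V → V) (B : Submodule K V) (n : ℕ) :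
    Module.finrank K ↥((fun W => W ⊔ Submodule.span K {m W})^[n] B) ≤ Module.finrank K B + n := by
  induction n with
  | zero => exact le_rfl
  | succ n ih =>
    rw [Function.iterate_succ_apply']
    refine (Submodule.finrank_add_le_finrank_add_finrank _ _).trans ?_
    have := finrank_span_le_card (R := K)
      ({m ((fun W => W ⊔ Submodule.span K {m W})^[n] B)} : Set V)
    simp only [Set.toFinset_singleton, Finset.card_singleton] at this
    omega

theorem eq_zero_of_sum_smul_mem {K V : Type*} [DivisionRing K] [AddCommGroup V] [Module K V]
    {B : Submodule K V} {k : ℕ} {z : Fin k → V}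
    (hz : ∀ i, z i ∉ B ⊔ Submodule.span K (z '' {j | j < i}))
    {t : Fin k → K} (ht : ∑ i, t i • z i ∈ B) : t = 0 := by
  classical
  by_contra hne
  obtain ⟨i₀, hi₀⟩ := Function.ne_iff.1 hne
  obtain ⟨i, hi, hmax⟩ := Finset.exists_max_image
    (Finset.univ.filter fun i => t i ≠ 0) id ⟨i₀, by simpa using hi₀⟩
  simp only [Finset.mem_filter, Finset.mem_univ, true_and, id] at hi hmax
  refine hz i (((B ⊔ _).smul_mem_iff hi).1 ?_)
  rw [← Finset.add_sum_erase _ _ (Finset.mem_univ i)] at ht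
  rw [← Submodule.add_mem_iff_left _ (y := ∑ j ∈ Finset.univ.erase i, t j • z j)]
  · exact Submodule.mem_sup_left ht
  refine Submodule.sum_mem _ fun j hj => ?_
  by_cases htj : t j = 0
  · simp [htj]
  · exact Submodule.mem_sup_right (Submodule.smul_mem _ _ (Submodule.subset_span
      ⟨j, lt_of_le_of_ne (hmax j htj) (Finset.ne_of_mem_erase hj), rfl⟩))

theorem le_sup_span_range_of_sum_smul_mem {K V : Type*} [DivisionRing K] [AddCommGroup V]
    [Module K V] [FiniteDimensional K V] {Z B : Submodule K V} {k : ℕ}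
    (hk : k = Module.finrank K (↥Z ⧸ B.comap Z.subtype)) {z : Fin k → V} (hzZ : ∀ i, z i ∈ Z)
    (hz : ∀ t : Fin k → K, ∑ i, t i • z i ∈ B → t = 0) :
    Z ≤ B ⊔ Submodule.span K (Set.range z) := by
  let q := (B.comap Z.subtype).mkQ
  let v : Fin k → ↥Z ⧸ B.comap Z.subtype := fun i => q ⟨z i, hzZ i⟩
  have hsum (t : Fin k → K) : ∑ i, t i • v i = q (∑ i, t i • ⟨z i, hzZ i⟩) := by
    simp only [v, map_sum, map_smul]
  have hv : LinearIndependent K v := by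
    refine Fintype.linearIndependent_iff.2 fun t ht => congrFun (hz t ?_)
    rw [hsum, Submodule.mkQ_apply, Submodule.Quotient.mk_eq_zero] at ht
    simpa using ht
  have hspan := hv.span_eq_top_of_card_eq_finrank' (by simpa using hk)
  intro y hy
  have hmem : q ⟨y, hy⟩ ∈ Submodule.span K (Set.range v) := hspan ▸ Submodule.mem_top
  obtain ⟨t, ht⟩ := (Submodule.mem_span_range_iff_exists_fun K).1 hmem
  rw [hsum, Submodule.mkQ_apply, Submodule.mkQ_apply, eq_comm, Submodule.Quotient.eq] at ht
  rw [← sub_add_cancel y (∑ i, t i • z i)]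
  refine add_mem (Submodule.mem_sup_left (by simpa using ht)) (Submodule.mem_sup_right ?_)
  exact Submodule.sum_mem _ fun i _ =>
    Submodule.smul_mem _ _ (Submodule.subset_span (Set.mem_range_self i))

theorem eq_of_forall_isColexLeast {σ : Type*} [Fintype σ] [DecidableEq σ] {w : σ → ℝ}
    (hw : Function.Injective w) {Z B : Submodule (ZMod 2) (σ → ZMod 2)} {k : ℕ}
    {z z' : Fin k → (σ → ZMod 2)}
    (hz : ∀ i, IsColexLeast w Z (B ⊔ Submodule.span (ZMod 2) (z '' {j | j < i})) (z i))
    (hz' : ∀ i, IsColexLeast w Z (B ⊔ Submodule.span (ZMod 2) (z' '' {j | j < i})) (z' i)) :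
    z = z' := by
  funext i
  induction i using WellFoundedLT.induction with
  | ind i ih =>
    have himage : z '' {j | j < i} = z' '' {j | j < i} := Set.image_congr ih
    exact (himage ▸ hz i).unique hw (hz' i)

/-- existence and uniqueness of the lexicographic-optimal homology
basis. `Z` (cycles) and `B ≤ Z` (boundaries) are `ZMod 2`-submodules of the chain
space `σ → ZMod 2` and `k` is the dimension of the homology `Z/B`. There is a
unique sequence `z 0, …, z (k-1)` of cycles such that each `z i` is the colex-least
cycle of `Z` not lying in `B ⊔ span {z j | j < i}`; moreover for any such sequence,
the images of the `z i` form a basis of `Z/B`: they span the quotient (every cycle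
lies in `B ⊔ span (range z)`) and are linearly independent mod `B` (a combination
`∑ t i • z i` is a boundary only if all `t i = 0`). -/
theorem lex_optimal_basis_exists_unique {σ : Type*} [Fintype σ] [DecidableEq σ]
    (w : σ → ℝ) (hw : Function.Injective w) (hpos : ∀ s, 0 < w s)
    (Z B : Submodule (ZMod 2) (σ → ZMod 2)) (hBZ : B ≤ Z)
    (k : ℕ) (hk : k = Module.finrank (ZMod 2) (↥Z ⧸ B.comap Z.subtype)) :
    (∃! z : Fin k → (σ → ZMod 2), ∀ i : Fin k,
        z i ∈ Z ∧ z i ∉ B ⊔ Submodule.span (ZMod 2) (z '' {j | j < i}) ∧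
        ∀ y ∈ Z, y ∉ B ⊔ Submodule.span (ZMod 2) (z '' {j | j < i}) →
          colexLe w (supp (z i)) (supp y)) ∧
    (∀ z : Fin k → (σ → ZMod 2),
      (∀ i : Fin k,
        z i ∈ Z ∧ z i ∉ B ⊔ Submodule.span (ZMod 2) (z '' {j | j < i}) ∧
        ∀ y ∈ Z, y ∉ B ⊔ Submodule.span (ZMod 2) (z '' {j | j < i}) →
          colexLe w (supp (z i)) (supp y)) →
      Z ≤ B ⊔ Submodule.span (ZMod 2) (Set.range z) ∧
      ∀ t : Fin k → ZMod 2, (∑ i : Fin k, t i • z i) ∈ B → t = 0) := by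
  classical
  refine ⟨?_, fun z hz => ?_⟩
  · have hdim : k + Module.finrank (ZMod 2) B = Module.finrank (ZMod 2) Z := by
      rw [hk, ← (Submodule.comapSubtypeEquivOfLe hBZ).finrank_eq]
      exact Submodule.finrank_quotient_add_finrank _
    let m : Submodule (ZMod 2) (σ → ZMod 2) → (σ → ZMod 2) := fun W =>
      if h : Z ≤ W then 0 else (IsColexLeast.exists_of_not_le hw h).choose
    have hm {W} (h : ¬Z ≤ W) : IsColexLeast w Z W (m W) := by
      simp only [m, dif_neg h]
      exact (IsColexLeast.exists_of_not_le hw h).choose_spec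
    let F := fun W => W ⊔ Submodule.span (ZMod 2) {m W}
    refine existsUnique_of_exists_of_unique ⟨fun i => m (F^[i] B), fun i => ?_⟩
      fun z z' hz hz' => eq_of_forall_isColexLeast hw hz hz'
    · have himage : (fun i : Fin k => m (F^[i] B)) '' {j | j < i} =
          (fun j : ℕ => m (F^[j] B)) '' {j | j < (i : ℕ)} := by
        ext x
        constructor
        · rintro ⟨j, hj, rfl⟩
          exact ⟨j, hj, rfl⟩
        · rintro ⟨j, hj, rfl⟩
          exact ⟨⟨j, lt_trans hj i.2⟩, hj, rfl⟩
      rw [himage, ← iterate_sup_span_singleton m B i]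
      refine hm fun h => ?_
      have h₁ := Submodule.finrank_mono h
      have h₂ : Module.finrank (ZMod 2) ↥(F^[i] B) ≤ _ :=
        finrank_iterate_sup_span_singleton_le m B i
      have := i.2
      omega
  · have hindep : ∀ t : Fin k → ZMod 2, (∑ i, t i • z i) ∈ B → t = 0 :=
      fun t => eq_zero_of_sum_smul_mem fun i => (hz i).2.1
    exact ⟨le_sup_span_range_of_sum_smul_mem hk (fun i => (hz i).1) hindep, hindep⟩
end

section
/- Abstract form of the paper's Proposition on p-representatives: let σ be a finite type with an injective positive weight function w : σ → ℝ and bottleneck norm bn_w, let the chain space be the ℤ₂-vector space σ → ZMod 2 (chains identified with their supports), and let B ≤ Z be ZMod 2-submodules (boundaries inside cycles). Suppose z_1, …, z_k are cycles in Z such that, writing S_j = B + span{z_1, …, z_{j−1}}, for each j one has z_j ∉ S_j and bn_w(z_j) ≤ bn_w(y) for every cycle y ∈ Z with y ∉ S_j (each z_j is bottleneck-minimal among cycles whose homology class is not spanned by the classes of its predecessors, as is the case for persistence p-representatives). Then for every nonempty subset T ⊆ {1, …, k}, the cycle z_T = Σ_{j ∈ T} z_j is bottleneck-optimal in its homology class: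 bn_w(z_T) ≤ bn_w(y) for every y ∈ Z with y − z_T ∈ B. -/
open scoped symmDiff

theorem bn_le_iff {σ : Type*} {w : σ → ℝ} (hpos : ∀ s, 0 < w s) {c : Finset σ} {M : ℝ} :
    bn w c ≤ M ↔ 0 ≤ M ∧ ∀ s ∈ c, w s ≤ M := by
  unfold bn
  split_ifs with h
  · rw [Finset.sup'_le_iff]
    refine ⟨fun H => ⟨?_, H⟩, And.right⟩
    obtain ⟨s, hs⟩ := h
    exact (hpos s).le.trans (H s hs)
  · rw [Finset.not_nonempty_iff_eq_empty.mp h]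
    simp

theorem bn_supp_sum_le {σ ι : Type*} [Fintype σ] [DecidableEq σ] {w : σ → ℝ}
    (hpos : ∀ s, 0 < w s) {T : Finset ι} {z : ι → σ → ZMod 2} {M : ℝ} (hM : 0 ≤ M)
    (h : ∀ j ∈ T, bn w (supp (z j)) ≤ M) : bn w (supp (∑ j ∈ T, z j)) ≤ M := by
  refine (bn_le_iff hpos).2 ⟨hM, fun s hs => ?_⟩
  have hs' : ∑ j ∈ T, z j s ≠ 0 := by simpa [supp] using hs
  obtain ⟨j, hj, hjs⟩ := Finset.exists_ne_zero_of_sum_ne_zero hs'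
  exact ((bn_le_iff hpos).1 (h j hj)).2 s (by simpa [supp] using hjs)

/-- abstract form of the paper's proposition on p-representatives.
`Z` (cycles) and `B ≤ Z` (boundaries) are `ZMod 2`-submodules of the chain space
`σ → ZMod 2`. If each `z j` is a cycle which is bottleneck-minimal among the cycles
of `Z` not lying in `S j = B ⊔ span {z i | i < j}`, then for every nonempty
`T ⊆ Fin k` the cycle `∑ j ∈ T, z j` is bottleneck-optimal in its homology class. -/
theorem sum_of_p_representatives_is_bottleneck_optimal
    {σ : Type*} [Fintype σ] [DecidableEq σ]
    (w : σ → ℝ) (hw : Function.Injective w) (hpos : ∀ s, 0 < w s)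
    (Z B : Submodule (ZMod 2) (σ → ZMod 2)) (hBZ : B ≤ Z)
    (k : ℕ) (z : Fin k → (σ → ZMod 2))
    (hmem : ∀ j : Fin k, z j ∈ Z)
    (hnot : ∀ j : Fin k, z j ∉ B ⊔ Submodule.span (ZMod 2) (z '' {i | i < j}))
    (hmin : ∀ j : Fin k, ∀ y ∈ Z,
      y ∉ B ⊔ Submodule.span (ZMod 2) (z '' {i | i < j}) →
      bn w (supp (z j)) ≤ bn w (supp y)) :
    ∀ T : Finset (Fin k), T.Nonempty →
      ∀ y ∈ Z, y - (∑ j ∈ T, z j) ∈ B →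
        bn w (supp (∑ j ∈ T, z j)) ≤ bn w (supp y) := by
  intro T hT y hy hyB
  have hmono : ∀ i j, i ≤ j → bn w (supp (z i)) ≤ bn w (supp (z j)) := fun i j hij =>
    hmin i (z j) (hmem j) fun h => hnot j <| sup_le_sup_left
      (Submodule.span_mono <| Set.image_mono fun _ hl => lt_of_lt_of_le hl hij) B h
  set m := T.max' hT
  have hmT : m ∈ T := T.max'_mem hT
  refine le_trans (bn_supp_sum_le hpos ((bn_le_iff hpos).1 le_rfl).1
    fun j hj => hmono j m (T.le_max' j hj)) (hmin m y hy fun hyS => hnot m ?_)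
  have hrest : ∑ j ∈ T.erase m, z j ∈ B ⊔ Submodule.span (ZMod 2) (z '' {i | i < m}) :=
    Submodule.sum_mem _ fun j hj => Submodule.mem_sup_right <| Submodule.subset_span
      ⟨j, T.lt_max'_of_mem_erase_max' hT hj, rfl⟩
  have hz : z m = y - (y - ∑ j ∈ T, z j) - ∑ j ∈ T.erase m, z j := by
    rw [← Finset.add_sum_erase T z hmT]
    abel
  rw [hz]
  exact Submodule.sub_mem _ (Submodule.sub_mem _ hyS (Submodule.mem_sup_left hyB)) hrest
end
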